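/- For all integers n ≥ 1 and 1 ≤ k ≤ n, the number of André permutations of [n] whose last entry is k equals the number of down-up alternating permutations of [n] whose first entry is k; that is, #A_{n,k} = #DU_{n,k} (and hence both equal the Entringer number E_{n,k}). -/

import Mathlib

/-- `w` is a down-up alternating word: `w 0 > w 1 < w 2 > w 3 < ⋯` (0-indexed). -/
def DownUpWord {α : Type*} [LT α] (w : List α) : Prop :=
  ∀ i : ℕ, ∀ h : i + 1 < w.length,
    (i % 2 = 0 → w.get ⟨i + 1, h⟩ < w.get ⟨i, Nat.lt_of_succ_lt h⟩) ∧
    (i % 2 = 1 → w.get ⟨i, Nat.lt_of_succ_lt h⟩ < w.get ⟨i + 1, h⟩)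

/-- A word has a double descent if `w i > w (i+1) > w (i+2)` for some `i`. -/
def HasDoubleDescent {α : Type*} [LT α] (w : List α) : Prop :=
  ∃ i : ℕ, ∃ h : i + 2 < w.length,
    w.get ⟨i + 1, by omega⟩ < w.get ⟨i, by omega⟩ ∧
    w.get ⟨i + 2, h⟩ < w.get ⟨i + 1, by omega⟩

/-- A word ends with an ascent if it has length 1 or its last two letters increase. -/
def EndsWithAscent {α : Type*} [LT α] (w : List α) : Prop :=
  w.length = 1 ∨ ∃ h : 2 ≤ w.length,
    w.get ⟨w.length - 2, by omega⟩ < w.get ⟨w.length - 1, by omega⟩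

/-- André permutation of `[n]`, as a list that is a permutation of `1, …, n`:
every subword `σ_[k]` (entries `1, …, k` in the order they appear) has no
double descents and ends with an ascent. -/
def IsAndre (n : ℕ) (l : List ℕ) : Prop :=
  l.Perm (List.range' 1 n) ∧
  ∀ k : ℕ, 1 ≤ k → k ≤ n →
    ¬ HasDoubleDescent (l.filter (fun x => decide (x ≤ k))) ∧
    EndsWithAscent (l.filter (fun x => decide (x ≤ k)))

/-- The number of ways to perform `j` successive insertions of a new maximum, none of them at the
end, into an André word with `d` descents and `e` ascents not preceded by a descent. -/
def innerExtensions : ℕ → ℕ → ℕ → ℕ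
  | 0, _, _ => 1
  | j + 1, d, e => d * innerExtensions j d (e + 1) + e * innerExtensions j (d + 1) (e - 1)

/-- The number of ways to perform `i` arbitrary insertions of a new maximum, then one at the end,
then `j` insertions not at the end, into an André word with `d` descents and `e` ascents not
preceded by a descent. -/
def markedExtensions : ℕ → ℕ → ℕ → ℕ → ℕ
  | 0, j, d, e => innerExtensions j d (e + 1)
  | i + 1, j, d, e =>
      (d + 1) * markedExtensions i j d (e + 1) + e * markedExtensions i j (d + 1) (e - 1)

theorem innerExtensions_add_two (j d e : ℕ) :
    innerExtensions j d (e + 2) + innerExtensions j d e = 2 * innerExtensions j (d + 1) e := by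
  induction j generalizing d e with
  | zero => rfl
  | succ j ih =>
    have h1 := ih d (e + 1)
    rcases e with _ | e
    · simp only [innerExtensions, Nat.zero_add] at *
      linear_combination d * h1
    · have h2 := ih (d + 1) e
      simp only [innerExtensions, Nat.add_sub_cancel] at *
      rw [show e + 1 + 2 - 1 = e + 2 by omega]
      linear_combination d * h1 + (e + 1) * h2

theorem markedExtensions_second_difference (i j d e : ℕ) :
    markedExtensions (i + 2) j d e + markedExtensions i (j + 2) d e + markedExtensions i j d e =
      2 * markedExtensions (i + 1) (j + 1) d e := by
  induction i generalizing d e with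
  | zero =>
    have h := innerExtensions_add_two j d (e + 1)
    rcases e with _ | _ | e
    · simp only [markedExtensions, innerExtensions, Nat.zero_add, zero_mul, add_zero,
        Nat.add_assoc, Nat.reduceAdd] at *
      linear_combination h
    · simp only [markedExtensions, innerExtensions, Nat.zero_add, Nat.add_assoc,
        Nat.reduceAdd, Nat.reduceSub, one_mul] at *
      linear_combination h
    · have h2 : ∀ a, a + 2 - 1 = a + 1 := fun _ => rfl
      simp only [markedExtensions, innerExtensions, Nat.add_sub_cancel, Nat.add_assoc,
        Nat.reduceAdd, h2] at *
      linear_combination h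
  | succ i ih =>
    have hstep : ∀ i' j', markedExtensions (i' + 1) j' d e =
      (d + 1) * markedExtensions i' j' d (e + 1) + e * markedExtensions i' j' (d + 1) (e - 1) :=
      fun _ _ => rfl
    rw [hstep (i + 2) j, hstep i (j + 2), hstep i j, hstep (i + 1) (j + 1)]
    linear_combination (d + 1) * ih d (e + 1) + e * ih (d + 1) (e - 1)

theorem markedExtensions_zero_right (i d e : ℕ) :
    markedExtensions i 0 d e = innerExtensions i (d + 1) e := by
  induction i generalizing d e with
  | zero => rfl
  | succ i ih => rw [markedExtensions, innerExtensions, ih, ih]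

theorem innerExtensions_succ_zero_zero (j : ℕ) : innerExtensions (j + 1) 0 0 = 0 := by
  simp [innerExtensions]

theorem entringer_eq_markedExtensions (E : ℕ → ℕ → ℕ) (hE11 : E 1 1 = 1)
    (hEn1 : ∀ n : ℕ, 2 ≤ n → E n 1 = 0)
    (hErec : ∀ n k : ℕ, 2 ≤ k → k ≤ n → E n k = E n (k - 1) + E (n - 1) (n + 1 - k))
    (i j : ℕ) : E (i + j + 2) (i + 2) = markedExtensions i j 0 0 := by
  induction hn : i + j using Nat.strong_induction_on generalizing i j with
  | _ n ihn =>
  subst hn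
  induction i using Nat.strong_induction_on generalizing j with
  | _ i ihi =>
  have hrec : ∀ i j, E (i + j + 2) (i + 2) = E (i + j + 2) (i + 1) + E (i + j + 1) (j + 1) := by
    intro i j
    have h := hErec (i + j + 2) (i + 2) (by omega) (by omega)
    rwa [show i + j + 2 + 1 - (i + 2) = j + 1 by omega] at h
  rcases i with _ | _ | i
  · rw [hrec]
    have h1 := hEn1 (0 + j + 2) (by omega)
    rcases j with _ | j
    · rw [h1]
      simp [markedExtensions, innerExtensions, hE11]
    · have h2 := ihn (j + 0) (by omega) j 0 rfl
      rw [markedExtensions_zero_right] at h2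
      rw [h1, show 0 + (j + 1) + 1 = j + 0 + 2 by omega, show j + 1 + 1 = j + 2 by omega, h2]
      simp [markedExtensions, innerExtensions]
  · rw [hrec]
    have h0 := ihi 0 (by omega) (j + 1) (by
      intro m hm i' j' h
      exact ihn m (by omega) i' j' h)
    have h3 := innerExtensions_add_two j 0 0
    rcases j with _ | j
    · have h1 := hEn1 2 (by omega)
      simp only [markedExtensions, innerExtensions, Nat.zero_add, Nat.add_zero, Nat.reduceAdd] at *
      omega
    · have h1 := ihn (j + 1) (by omega) (j + 1) 0 (by omega)
      have h2 := hrec (j + 1) 0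
      have h4 := hEn1 (j + 1 + 0 + 1) (by omega)
      rw [innerExtensions_succ_zero_zero] at h3
      rw [markedExtensions_zero_right] at h1
      have h5 : markedExtensions 0 (j + 1 + 1) 0 0 = innerExtensions (j + 1) 1 0 := by
        simp [markedExtensions, innerExtensions]
      have h6 : markedExtensions (0 + 1) (j + 1) 0 0 = innerExtensions (j + 1) 0 2 := by
        simp [markedExtensions]
      simp only [Nat.zero_add, Nat.add_zero, Nat.add_assoc, Nat.reduceAdd,
        Nat.add_comm 1 _] at *
      omega
  · have h1 := ihi (i + 1) (by omega) (j + 1) (by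
      intro m hm i' j' h
      exact ihn m (by omega) i' j' h)
    have h2 := ihi i (by omega) (j + 2) (by
      intro m hm i' j' h
      exact ihn m (by omega) i' j' h)
    have h3 := ihn (i + j) (by omega) i j rfl
    have e1 := hrec (i + 2) j
    have e2 := hrec (i + 1) (j + 1)
    have e3 := hrec j (i + 1)
    have e4 := markedExtensions_second_difference i j 0 0
    rw [show i + 2 + j = i + j + 2 by omega] at e1
    rw [show i + 1 + (j + 1) = i + j + 2 by omega] at h1 e2
    rw [show i + (j + 2) = i + j + 2 by omega] at h2
    rw [show j + (i + 1) = i + j + 1 by omega] at e3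
    rw [show i + 1 + 1 + j = i + j + 2 by omega]
    simp only [Nat.add_assoc, Nat.reduceAdd] at *
    omega

/-- A nonempty word without double descents that ends with an ascent. -/
def AscendingTail : List ℕ → Prop
  | [] => False
  | [_] => True
  | [x, y] => x < y
  | x :: y :: z :: t => (x < y ∨ y < z) ∧ AscendingTail (y :: z :: t)

/-- The number of descents of a word. -/
def descents : List ℕ → ℕ
  | [] => 0
  | [_] => 0
  | x :: y :: t => (if x < y then 0 else 1) + descents (y :: t)

/-- All words obtained by inserting `N` in front of the bottom of an ascent. -/
def innerInsertions (N : ℕ) : List ℕ → List (List ℕ)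
  | [] => []
  | [_] => []
  | x :: y :: t =>
      (if x < y then [N :: x :: y :: t] else []) ++ (innerInsertions N (y :: t)).map (x :: ·)

theorem AscendingTail.tail {x y : ℕ} {t : List ℕ} (h : AscendingTail (x :: y :: t)) :
    AscendingTail (y :: t) := by
  cases t with
  | nil => trivial
  | cons z t => exact h.2

theorem ascendingTail_iff {l : List ℕ} (hl : l ≠ []) (hnd : l.Nodup) :
    AscendingTail l ↔ ¬ HasDoubleDescent l ∧ EndsWithAscent l := by
  induction l with
  | nil => exact absurd rfl hl
  | cons x l ih =>
    rcases l with _ | ⟨y, _ | ⟨z, t⟩⟩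
    · simp [AscendingTail, HasDoubleDescent, EndsWithAscent]
    · simp [AscendingTail, HasDoubleDescent, EndsWithAscent]
    · have hends : EndsWithAscent (x :: y :: z :: t) ↔ EndsWithAscent (y :: z :: t) := by
        simp [EndsWithAscent]
      have hdd : HasDoubleDescent (x :: y :: z :: t) ↔
          (y < x ∧ z < y) ∨ HasDoubleDescent (y :: z :: t) := by
        constructor
        · rintro ⟨_ | i, h, h1⟩
          · exact Or.inl h1
          · exact Or.inr ⟨i, by simpa using h, h1⟩
        · rintro (h | ⟨i, h, h1⟩)
          · exact ⟨0, by simp, h⟩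
          · exact ⟨i + 1, by simpa using h, h1⟩
      rw [hends, hdd, AscendingTail, ih (by simp) hnd.of_cons]
      simp only [List.nodup_cons, List.mem_cons, not_or] at hnd
      have h1 := hnd.1.1
      have h2 := hnd.2.1.1
      rw [show (x < y ∨ y < z) ↔ ¬ (y < x ∧ z < y) by omega]
      tauto

theorem two_mul_descents_lt_length {l : List ℕ} (hl : AscendingTail l) :
    2 * descents l < l.length := by
  induction hk : l.length using Nat.strong_induction_on generalizing l with
  | _ n ih =>
  subst hk
  rcases l with _ | ⟨x, _ | ⟨y, t⟩⟩
  · exact hl.elim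
  · simp [descents]
  · by_cases hxy : x < y
    · have := ih _ (by simp) hl.tail rfl
      simp_all [descents]
      omega
    · rcases t with _ | ⟨z, t⟩
      · exact absurd hl hxy
      · have hyz : y < z := hl.1.resolve_left hxy
        have := ih _ (by simp) hl.tail.tail rfl
        simp only [descents, hxy, hyz, if_true, if_false, List.length_cons] at *
        omega

theorem exists_append_of_mem_innerInsertions {N : ℕ} {l l' : List ℕ}
    (h : l' ∈ innerInsertions N l) : ∃ u v, v ≠ [] ∧ l = u ++ v ∧ l' = u ++ N :: v := by
  induction l generalizing l' with
  | nil => simp [innerInsertions] at h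
  | cons x l ih =>
    rcases l with _ | ⟨y, t⟩
    · simp [innerInsertions] at h
    · simp only [innerInsertions, List.mem_append, List.mem_map] at h
      rcases h with h | ⟨w, hw, rfl⟩
      · split_ifs at h
        · exact ⟨[], _, by simp, rfl, by simpa using h⟩
        · simp at h
      · obtain ⟨u, v, hv, h1, rfl⟩ := ih hw
        exact ⟨x :: u, v, hv, by simp [h1], rfl⟩

theorem mem_innerInsertions_of_ascendingTail {N : ℕ} {u v : List ℕ} (hv : v ≠ [])
    (hlt : ∀ x ∈ v, x < N) (h : AscendingTail (u ++ N :: v)) :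
    u ++ N :: v ∈ innerInsertions N (u ++ v) := by
  induction u with
  | nil =>
    rcases v with _ | ⟨x, _ | ⟨y, t⟩⟩
    · exact absurd rfl hv
    · have := hlt x (by simp)
      have h : N < x := h
      omega
    · have := hlt x (by simp)
      have hxy : x < y := h.1.resolve_left (by omega)
      simp [innerInsertions, hxy]
  | cons a u ih =>
    have h' : AscendingTail (u ++ N :: v) := by
      rcases u with _ | ⟨b, u⟩
      · exact AscendingTail.tail h
      · exact AscendingTail.tail h
    have hm := ih h'
    obtain ⟨b, c, hbc⟩ := List.exists_cons_of_ne_nil (l := u ++ v) (by simp [hv])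
    rw [List.cons_append, List.cons_append, hbc, innerInsertions]
    rw [hbc] at hm
    exact List.mem_append_right _ (List.mem_map_of_mem hm)

theorem head_of_mem_innerInsertions {N x : ℕ} {t w : List ℕ}
    (h : w ∈ innerInsertions N (x :: t)) : (∃ s, w = x :: s) ∨ ∃ s, w = N :: s := by
  obtain ⟨_ | ⟨a, u⟩, v, hv, h1, rfl⟩ := exists_append_of_mem_innerInsertions h
  · exact Or.inr ⟨_, rfl⟩
  · simp only [List.cons_append, List.cons.injEq] at h1
    exact Or.inl ⟨u ++ N :: v, by simp [h1.1]⟩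

theorem AscendingTail.cons {x y : ℕ} {t : List ℕ} (hxy : x < y) (h : AscendingTail (y :: t)) :
    AscendingTail (x :: y :: t) := by
  cases t with
  | nil => exact hxy
  | cons z t => exact ⟨Or.inl hxy, h⟩

theorem ascendingTail_of_mem_innerInsertions {N : ℕ} {l w : List ℕ} (hlt : ∀ x ∈ l, x < N)
    (hl : AscendingTail l) (h : w ∈ innerInsertions N l) : AscendingTail w := by
  induction hk : l.length using Nat.strong_induction_on generalizing l w with
  | _ n ih =>
  subst hk
  rcases l with _ | ⟨x, _ | ⟨y, t⟩⟩
  · exact hl.elim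
  · simp [innerInsertions] at h
  · by_cases hxy : x < y
    · simp only [innerInsertions, hxy, if_true, List.mem_append, List.mem_singleton,
        List.mem_map] at h
      rcases h with rfl | ⟨w, hw, rfl⟩
      · exact ⟨Or.inr hxy, hl⟩
      · have h2 := ih _ (by simp) (fun z hz => hlt z (by simp_all)) hl.tail hw rfl
        have hxN := hlt x (by simp)
        rcases head_of_mem_innerInsertions hw with ⟨s, rfl⟩ | ⟨s, rfl⟩
        · exact h2.cons hxy
        · exact h2.cons hxN
    · rcases t with _ | ⟨z, t⟩
      · exact absurd hl hxy
      · have hyz : y < z := hl.1.resolve_left hxy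
        have hxN := hlt x (by simp)
        have hyN := hlt y (by simp)
        simp only [innerInsertions, hxy, if_false, List.nil_append, hyz, if_true,
          List.map_append, List.map_cons, List.map_nil, List.map_map, List.mem_append,
          List.mem_singleton] at h
        rcases h with rfl | h
        · exact ⟨Or.inl hxN, Or.inr hyz, hl.tail⟩
        · obtain ⟨w, hw, rfl⟩ := List.mem_map.1 h
          have h2 := ih _ (by simp) (fun a ha => hlt a (by simp_all)) hl.tail.tail hw rfl
          rcases head_of_mem_innerInsertions hw with ⟨s, rfl⟩ | ⟨s, rfl⟩
          · exact ⟨Or.inr hyz, h2.cons hyz⟩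
          · exact ⟨Or.inr hyN, h2.cons hyN⟩

theorem AscendingTail.append_singleton {N : ℕ} {l : List ℕ} (hlt : ∀ x ∈ l, x < N)
    (hl : AscendingTail l) : AscendingTail (l ++ [N]) := by
  induction l with
  | nil => exact hl.elim
  | cons x l ih =>
    rcases l with _ | ⟨y, _ | ⟨z, t⟩⟩
    · exact hlt x (by simp)
    · exact ⟨Or.inl hl, hlt y (by simp)⟩
    · exact ⟨hl.1, ih (fun a ha => hlt a (by simp_all)) hl.2⟩

theorem descents_append_singleton {N : ℕ} {l : List ℕ} (hlt : ∀ x ∈ l, x < N) :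
    descents (l ++ [N]) = descents l := by
  induction l with
  | nil => rfl
  | cons x l ih =>
    rcases l with _ | ⟨y, t⟩
    · simp_all [descents]
    · have := ih (fun a ha => hlt a (by simp_all))
      simp only [List.cons_append, descents] at *
      rw [this]

theorem sum_innerInsertions {N : ℕ} {l : List ℕ} (hlt : ∀ x ∈ l, x < N) (hl : AscendingTail l)
    (F : ℕ → ℕ) :
    ((innerInsertions N l).map fun w => F (descents w)).sum =
      descents l * F (descents l) + (l.length - 1 - 2 * descents l) * F (descents l + 1) := by
  induction hk : l.length using Nat.strong_induction_on generalizing l F with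
  | _ n ih =>
  subst hk
  rcases l with _ | ⟨x, _ | ⟨y, t⟩⟩
  · exact hl.elim
  · simp [innerInsertions, descents]
  · have hxN := hlt x (by simp)
    have hyN := hlt y (by simp)
    by_cases hxy : x < y
    · have hd : ∀ w ∈ innerInsertions N (y :: t), descents (x :: w) = descents w := by
        intro w hw
        rcases head_of_mem_innerInsertions hw with ⟨s, rfl⟩ | ⟨s, rfl⟩ <;> simp [descents, *]
      have h1 := ih _ (by simp) (fun z hz => hlt z (by simp_all)) hl.tail F rfl
      have h2 := two_mul_descents_lt_length hl.tail
      simp only [innerInsertions, hxy, if_true, List.map_append, List.map_cons, List.map_nil,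
        List.sum_append, List.sum_cons, List.sum_nil, List.map_map]
      rw [List.map_congr_left (g := fun w => F (descents w))
        (fun w hw => by simp [hd w hw]), h1]
      have h3 : descents (x :: y :: t) = descents (y :: t) := by simp [descents, hxy]
      have h4 : descents (N :: x :: y :: t) = descents (y :: t) + 1 := by
        simp [descents, hxy, hxN.not_gt, add_comm]
      obtain ⟨c, hc⟩ : ∃ c, (y :: t).length - 1 - 2 * descents (y :: t) = c := ⟨_, rfl⟩
      have hc' : (x :: y :: t).length - 1 - 2 * descents (y :: t) = c + 1 := by
        simp only [List.length_cons] at *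
        omega
      rw [h3, h4, hc, hc']
      ring
    · rcases t with _ | ⟨z, t⟩
      · exact absurd hl hxy
      · have hyz : y < z := hl.1.resolve_left hxy
        have hd : ∀ w ∈ innerInsertions N (z :: t), descents (x :: y :: w) = descents w + 1 := by
          intro w hw
          rcases head_of_mem_innerInsertions hw with ⟨s, rfl⟩ | ⟨s, rfl⟩ <;>
            simp [descents, *, add_comm]
        have h1 := ih _ (by simp) (fun a ha => hlt a (by simp_all)) hl.tail.tail
          (fun d => F (d + 1)) rfl
        have h2 := two_mul_descents_lt_length hl.tail.tail
        simp only [innerInsertions, hxy, if_false, hyz, if_true, List.map_append, List.map_cons,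
          List.map_nil, List.nil_append, List.sum_append, List.sum_cons, List.sum_nil,
          List.map_map]
        have h3 : descents (x :: y :: z :: t) = descents (z :: t) + 1 := by
          simp [descents, hxy, hyz, add_comm]
        have h4 : descents (x :: N :: y :: z :: t) = descents (z :: t) + 1 := by
          simp [descents, hxN, hyz, hyN.not_gt, add_comm]
        rw [List.map_congr_left (g := fun w => F (descents w + 1))
          (fun w hw => by simp [hd w hw]), h1, h3, h4]
        have hc : (x :: y :: z :: t).length - 1 - 2 * (descents (z :: t) + 1) =
            (z :: t).length - 1 - 2 * descents (z :: t) := by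
          simp only [List.length_cons]
          omega
        rw [hc]
        ring

theorem nodup_innerInsertions {N : ℕ} {l : List ℕ} (hN : N ∉ l) :
    (innerInsertions N l).Nodup := by
  induction l with
  | nil => simp [innerInsertions]
  | cons x l ih =>
    rcases l with _ | ⟨y, t⟩
    · simp [innerInsertions]
    · simp only [List.mem_cons, not_or] at hN ih
      have h1 := (ih hN.2).map (f := (x :: ·)) (fun _ _ h => by simpa using h)
      rw [innerInsertions]
      split_ifs
      · rw [List.singleton_append, List.nodup_cons]
        refine ⟨?_, h1⟩
        simp [Ne.symm hN.1]
      · simpa using h1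

/-- The André permutations of `[m + 1]`, generated by successive insertions of a new maximum. -/
def andreWords : ℕ → List (List ℕ)
  | 0 => [[1]]
  | m + 1 => (andreWords m).flatMap fun l => (l ++ [m + 2]) :: innerInsertions (m + 2) l

theorem filter_le_eq_self_of_perm_range' {n : ℕ} {l : List ℕ} (h : l.Perm (List.range' 1 n)) :
    l.filter (fun x => decide (x ≤ n)) = l := by
  rw [List.filter_eq_self]
  intro x hx
  have := List.mem_range'_1.1 (h.mem_iff.1 hx)
  simp only [decide_eq_true_eq]
  omega

theorem IsAndre.lt {n : ℕ} {l : List ℕ} (h : IsAndre n l) {x : ℕ} (hx : x ∈ l) : x < n + 1 := by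
  have := List.mem_range'_1.1 (h.1.mem_iff.1 hx)
  omega

theorem IsAndre.ascendingTail {n : ℕ} {l : List ℕ} (h : IsAndre (n + 1) l) : AscendingTail l := by
  have h1 := h.2 (n + 1) (by omega) le_rfl
  rw [filter_le_eq_self_of_perm_range' h.1] at h1
  refine (ascendingTail_iff ?_ (h.1.nodup_iff.2 List.nodup_range')).2 h1
  rintro rfl
  simpa using h.1.length_eq

theorem filter_insert_max {u v : List ℕ} {N k : ℕ} (h : k < N) :
    (u ++ N :: v).filter (fun x => decide (x ≤ k)) = (u ++ v).filter (fun x => decide (x ≤ k)) := by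
  simp [List.filter_append, h.not_ge]

theorem perm_insert_max_iff {u v : List ℕ} {n : ℕ} :
    (u ++ (n + 1) :: v).Perm (List.range' 1 (n + 1)) ↔ (u ++ v).Perm (List.range' 1 n) := by
  rw [List.range'_1_concat, add_comm 1 n]
  rw [List.perm_middle.congr_left, (List.perm_append_singleton _ _).congr_right, List.perm_cons]

theorem isAndre_insert_max_iff {u v : List ℕ} {n : ℕ} :
    IsAndre (n + 1) (u ++ (n + 1) :: v) ↔ IsAndre n (u ++ v) ∧ AscendingTail (u ++ (n + 1) :: v) := by
  constructor
  · intro h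
    refine ⟨⟨perm_insert_max_iff.1 h.1, fun k hk hkn => ?_⟩, h.ascendingTail⟩
    rw [← filter_insert_max (N := n + 1) (by omega)]
    exact h.2 k hk (by omega)
  · rintro ⟨h, h1⟩
    have hp := perm_insert_max_iff.2 h.1
    refine ⟨hp, fun k hk hkn => ?_⟩
    rcases Nat.lt_or_ge k (n + 1) with h2 | h2
    · rw [filter_insert_max h2]
      exact h.2 k hk (by omega)
    · obtain rfl : k = n + 1 := by omega
      rw [filter_le_eq_self_of_perm_range' hp]
      exact (ascendingTail_iff (by simp) (hp.nodup_iff.2 List.nodup_range')).1 h1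

theorem mem_andreWords_iff {m : ℕ} {l : List ℕ} : l ∈ andreWords m ↔ IsAndre (m + 1) l := by
  induction m generalizing l with
  | zero =>
    rw [andreWords, List.mem_singleton]
    constructor
    · rintro rfl
      refine ⟨by simp, fun k hk hk1 => ?_⟩
      simp [HasDoubleDescent, EndsWithAscent, hk]
    · intro h
      simpa using h.1
  | succ m ih =>
    simp only [andreWords, List.mem_flatMap, List.mem_cons]
    constructor
    · rintro ⟨w, hw, hl⟩
      have hA := ih.1 hw
      have hlt : ∀ x ∈ w, x < m + 2 := fun x hx => hA.lt hx
      rcases hl with rfl | hl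
      · rw [isAndre_insert_max_iff, List.append_nil]
        exact ⟨hA, hA.ascendingTail.append_singleton hlt⟩
      · have h1 := ascendingTail_of_mem_innerInsertions hlt hA.ascendingTail hl
        obtain ⟨u, v, -, rfl, rfl⟩ := exists_append_of_mem_innerInsertions hl
        exact isAndre_insert_max_iff.2 ⟨hA, h1⟩
    · intro h
      have hmem : m + 2 ∈ l := h.1.mem_iff.2 (List.mem_range'_1.2 (by omega))
      obtain ⟨u, v, rfl⟩ := List.append_of_mem hmem
      obtain ⟨hA, h1⟩ := isAndre_insert_max_iff.1 h
      refine ⟨u ++ v, ih.2 hA, ?_⟩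
      rcases eq_or_ne v [] with rfl | hv
      · left; simp
      · right
        exact mem_innerInsertions_of_ascendingTail hv
          (fun x hx => hA.lt (List.mem_append_right _ hx)) h1

theorem erase_of_mem_insertions {N : ℕ} {l w : List ℕ} (hN : N ∉ l)
    (h : w ∈ (l ++ [N]) :: innerInsertions N l) : w.erase N = l := by
  obtain ⟨u, v, rfl, rfl⟩ : ∃ u v, l = u ++ v ∧ w = u ++ N :: v := by
    rcases List.mem_cons.1 h with rfl | h
    · exact ⟨l, [], by simp, rfl⟩
    · obtain ⟨u, v, -, h⟩ := exists_append_of_mem_innerInsertions h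
      exact ⟨u, v, h⟩
  rw [List.mem_append, not_or] at hN
  rw [List.erase_append_right _ hN.1, List.erase_cons_head]

theorem getLast?_of_mem_innerInsertions {N : ℕ} {l w : List ℕ} (h : w ∈ innerInsertions N l) :
    w.getLast? = l.getLast? := by
  obtain ⟨u, v, hv, rfl, rfl⟩ := exists_append_of_mem_innerInsertions h
  obtain ⟨a, b, rfl⟩ := List.exists_cons_of_ne_nil hv
  simp [List.getLast?_append, List.getLast?_cons_cons]

theorem IsAndre.succ_notMem {n : ℕ} {l : List ℕ} (h : IsAndre n l) : n + 1 ∉ l :=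
  fun hm => (h.lt hm).false

theorem nodup_andreWords (m : ℕ) : (andreWords m).Nodup := by
  induction m with
  | zero => simp [andreWords]
  | succ m ih =>
    rw [andreWords, List.nodup_flatMap]
    have hN : ∀ l ∈ andreWords m, m + 2 ∉ l := fun l hl => (mem_andreWords_iff.1 hl).succ_notMem
    constructor
    · intro l hl
      refine List.nodup_cons.2 ⟨fun h => ?_, nodup_innerInsertions (hN l hl)⟩
      have h1 := getLast?_of_mem_innerInsertions h
      rw [List.getLast?_concat] at h1
      exact hN l hl (List.mem_of_getLast? h1.symm)
    · refine ih.imp_of_mem ?_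
      intro a b ha hb hab w hwa hwb
      exact hab ((erase_of_mem_insertions (hN a ha) hwa).symm.trans
        (erase_of_mem_insertions (hN b hb) hwb))

theorem sum_andreWords_succ (m : ℕ) (F : List ℕ → ℕ) :
    ((andreWords (m + 1)).map F).sum = ((andreWords m).map fun l =>
      F (l ++ [m + 2]) + ((innerInsertions (m + 2) l).map F).sum).sum := by
  rw [andreWords]
  induction andreWords m with
  | nil => rfl
  | cons a L ih => simp [ih, add_assoc]

theorem sum_innerInsertions_andreWords {m : ℕ} {l : List ℕ} (hl : l ∈ andreWords m)
    (F : ℕ → ℕ → ℕ) :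
    ((innerInsertions (m + 2) l).map fun w => F (descents w) (m + 1 - 2 * descents w)).sum =
      descents l * F (descents l) (m - 2 * descents l + 1) +
        (m - 2 * descents l) * F (descents l + 1) (m - 2 * descents l - 1) := by
  have hA := mem_andreWords_iff.1 hl
  have hlen : l.length = m + 1 := by simpa using hA.1.length_eq
  have h2 := two_mul_descents_lt_length hA.ascendingTail
  rw [sum_innerInsertions (fun x hx => hA.lt hx) hA.ascendingTail
    (fun d => F d (m + 1 - 2 * d)), hlen]
  congr 3 <;> omega

/-- The number of ways to extend an André permutation of `[m + 1]` that ends with `k` by `j`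
insertions of a new maximum not at the end. -/
def fixedLastSum (m k j : ℕ) : ℕ :=
  ((andreWords m).map fun l =>
    if l.getLast? = some k then innerExtensions j (descents l) (m - 2 * descents l) else 0).sum

theorem fixedLastSum_succ {m k : ℕ} (hk : k ≠ m + 2) (j : ℕ) :
    fixedLastSum (m + 1) k j = fixedLastSum m k (j + 1) := by
  rw [fixedLastSum, sum_andreWords_succ, fixedLastSum]
  congr 1
  refine List.map_congr_left fun l hl => ?_
  rw [List.getLast?_concat, if_neg (by simpa using hk.symm), zero_add]
  rw [List.map_congr_left (g := fun w => if l.getLast? = some k then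
    innerExtensions j (descents w) (m + 1 - 2 * descents w) else 0)
    (fun w hw => by rw [getLast?_of_mem_innerInsertions hw])]
  split_ifs
  · rw [sum_innerInsertions_andreWords hl, innerExtensions]
  · simp

theorem sum_markedExtensions (m i j : ℕ) :
    ((andreWords m).map fun l =>
      markedExtensions i j (descents l) (m - 2 * descents l)).sum =
        markedExtensions (i + m) j 0 0 := by
  induction m generalizing i with
  | zero => simp [andreWords, descents]
  | succ m ih =>
    rw [sum_andreWords_succ, show i + (m + 1) = i + 1 + m by omega, ← ih]
    congr 1
    refine List.map_congr_left fun l hl => ?_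
    have hA := mem_andreWords_iff.1 hl
    have hlen : l.length = m + 1 := by simpa using hA.1.length_eq
    have h2 := two_mul_descents_lt_length hA.ascendingTail
    rw [sum_innerInsertions_andreWords hl, markedExtensions,
      descents_append_singleton (fun x hx => hA.lt hx),
      show m + 1 - 2 * descents l = m - 2 * descents l + 1 by omega]
    ring

theorem fixedLastSum_succ_self (m j : ℕ) :
    fixedLastSum (m + 1) (m + 2) j = markedExtensions m j 0 0 := by
  rw [fixedLastSum, sum_andreWords_succ, ← zero_add m, ← sum_markedExtensions, zero_add]
  congr 1
  refine List.map_congr_left fun l hl => ?_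
  have hA := mem_andreWords_iff.1 hl
  have hlen : l.length = m + 1 := by simpa using hA.1.length_eq
  have h2 := two_mul_descents_lt_length hA.ascendingTail
  have hne : ∀ w ∈ innerInsertions (m + 2) l, w.getLast? ≠ some (m + 2) := by
    intro w hw h
    rw [getLast?_of_mem_innerInsertions hw] at h
    exact hA.succ_notMem (List.mem_of_getLast? h)
  rw [List.map_congr_left (g := fun _ => 0) (fun w hw => if_neg (hne w hw))]
  rw [List.getLast?_concat, if_pos rfl, markedExtensions,
    descents_append_singleton (fun x hx => hA.lt hx),
    show m + 1 - 2 * descents l = m - 2 * descents l + 1 by omega]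
  simp

theorem fixedLastSum_add {m k : ℕ} (hk : k ≤ m + 1) (r j : ℕ) :
    fixedLastSum (m + r) k j = fixedLastSum m k (j + r) := by
  induction r generalizing j with
  | zero => rfl
  | succ r ih =>
    rw [← add_assoc, fixedLastSum_succ (by omega), ih]
    congr 1
    omega

theorem card_andre_last (m k : ℕ) :
    Nat.card {l : List ℕ // IsAndre (m + 1) l ∧ l.getLast? = some k} = fixedLastSum m k 0 := by
  rw [Nat.subtype_card ((andreWords m).filter fun l => l.getLast? = some k).toFinset
    (by simp [mem_andreWords_iff]), List.toFinset_card_of_nodup ((nodup_andreWords m).filter _)]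
  simp only [fixedLastSum, innerExtensions]
  induction andreWords m with
  | nil => rfl
  | cons a L ih => by_cases h : a.getLast? = some k <;> simp [h, ih, add_comm]

theorem card_andre_last_eq_of_recurrence (E : ℕ → ℕ → ℕ) (hE11 : E 1 1 = 1)
    (hEn1 : ∀ n : ℕ, 2 ≤ n → E n 1 = 0)
    (hErec : ∀ n k : ℕ, 2 ≤ k → k ≤ n → E n k = E n (k - 1) + E (n - 1) (n + 1 - k))
    (n k : ℕ) (hk : 1 ≤ k) (hkn : k ≤ n) :
    Nat.card {l : List ℕ // IsAndre n l ∧ l.getLast? = some k} = E n k := by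
  obtain ⟨m, rfl⟩ : ∃ m, n = m + 1 := ⟨n - 1, by omega⟩
  rw [card_andre_last]
  rcases hk.eq_or_lt with rfl | hk
  · have h := fixedLastSum_add (m := 0) (k := 1) (by omega) m 0
    simp only [zero_add] at h
    rw [h]
    rcases m with _ | m
    · simp [fixedLastSum, andreWords, innerExtensions, hE11]
    · simp [fixedLastSum, andreWords, descents, innerExtensions_succ_zero_zero, hEn1]
  · obtain ⟨i, rfl⟩ : ∃ i, k = i + 2 := ⟨k - 2, by omega⟩
    obtain ⟨j, rfl⟩ : ∃ j, m = i + 1 + j := ⟨m - (i + 1), by omega⟩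
    rw [fixedLastSum_add (by omega), fixedLastSum_succ_self, zero_add,
      ← entringer_eq_markedExtensions E hE11 hEn1 hErec]
    congr 1
    omega

theorem downUpWord_cons_map_iff {k : ℕ} {t : List ℕ} {f : ℕ → ℕ}
    (hf : ∀ x ∈ t, ∀ y ∈ t, f x < f y ↔ y < x) :
    DownUpWord (k :: t) ↔ DownUpWord (t.map f) ∧ ∀ x, t.head? = some x → x < k := by
  constructor
  · intro h
    refine ⟨fun i hi => ?_, ?_⟩
    · rw [List.length_map] at hi
      have h1 := h (i + 1) (by simpa using hi)
      simp only [List.get_eq_getElem, List.getElem_cons_succ, List.getElem_map] at h1 ⊢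
      rw [hf _ (List.getElem_mem _) _ (List.getElem_mem _),
        hf _ (List.getElem_mem _) _ (List.getElem_mem _)]
      exact ⟨fun hp => h1.2 (by omega), fun hp => h1.1 (by omega)⟩
    · intro x hx
      obtain ⟨s, rfl⟩ := List.head?_eq_some_iff.1 hx
      exact (h 0 (by simp)).1 rfl
  · rintro ⟨h, h0⟩ i hi
    rcases i with _ | i
    · rcases t with _ | ⟨x, s⟩
      · simp at hi
      · exact ⟨fun _ => h0 x rfl, fun hp => by omega⟩
    · have hi' : i + 1 < t.length := by simpa using hi
      have h1 := h i (by simpa using hi')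
      simp only [List.get_eq_getElem, List.getElem_cons_succ, List.getElem_map] at h1 ⊢
      rw [hf _ (List.getElem_mem _) _ (List.getElem_mem _),
        hf _ (List.getElem_mem _) _ (List.getElem_mem _)] at h1
      exact ⟨fun hp => h1.2 (by omega), fun hp => h1.1 (by omega)⟩

theorem perm_range'_one_iff {n : ℕ} {l : List ℕ} :
    l.Perm (List.range' 1 n) ↔ l.Nodup ∧ ∀ x, x ∈ l ↔ 1 ≤ x ∧ x ≤ n := by
  constructor
  · intro h
    refine ⟨h.nodup_iff.2 List.nodup_range', fun x => ?_⟩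
    rw [h.mem_iff, List.mem_range'_1]
    omega
  · rintro ⟨h, h1⟩
    rw [List.perm_ext_iff_of_nodup h List.nodup_range']
    intro x
    rw [h1, List.mem_range'_1]
    omega

/-- The decreasing bijection from `[n + 1] \ {k}` to `[n]`. -/
def reverseSkip (n k x : ℕ) : ℕ := if x < k then n + 1 - x else n + 2 - x

/-- The decreasing bijection from `[n]` to `[n + 1] \ {k}`. -/
def reverseAvoid (n k y : ℕ) : ℕ := if n + 1 - y < k then n + 1 - y else n + 2 - y

/-- The set of down-up alternating permutations of `[n]` whose first entry satisfies `p`. -/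
def downUpFirst (n : ℕ) (p : ℕ → Prop) : Set (List ℕ) :=
  {l | l.Perm (List.range' 1 n) ∧ DownUpWord l ∧ ∃ k, l.head? = some k ∧ p k}

theorem finite_downUpFirst (n : ℕ) (p : ℕ → Prop) : (downUpFirst n p).Finite := by
  refine (List.finite_toSet (List.range' 1 n).permutations).subset fun l hl => ?_
  exact List.mem_permutations.2 hl.1

theorem ncard_downUpFirst_eq {n k : ℕ} (hn : 1 ≤ n) (hk : 1 ≤ k) (hkn : k ≤ n + 1) :
    (downUpFirst (n + 1) (· = k)).ncard = (downUpFirst n (n + 2 - k ≤ ·)).ncard := by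
  have hcons : ∀ {l : List ℕ}, l ∈ downUpFirst (n + 1) (· = k) → ∃ t, l = k :: t := by
    rintro l ⟨-, -, _, h, rfl⟩
    exact List.head?_eq_some_iff.1 h
  have hmem : ∀ {t : List ℕ}, (k :: t).Perm (List.range' 1 (n + 1)) →
      ∀ x ∈ t, x ≠ k ∧ 1 ≤ x ∧ x ≤ n + 1 := by
    intro t h x hx
    rw [perm_range'_one_iff] at h
    refine ⟨?_, (h.2 x).1 (List.mem_cons_of_mem _ hx)⟩
    rintro rfl
    exact (List.nodup_cons.1 h.1).1 hx
  have hleft : ∀ x, x ≠ k → 1 ≤ x → x ≤ n + 1 → reverseAvoid n k (reverseSkip n k x) = x := by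
    intro x h1 h2 h3
    unfold reverseAvoid reverseSkip
    split_ifs <;> omega
  have hright : ∀ y, 1 ≤ y → y ≤ n → reverseSkip n k (reverseAvoid n k y) = y := by
    intro x h2 h3
    unfold reverseAvoid reverseSkip
    split_ifs <;> omega
  have hanti : ∀ x y, x ≠ k → 1 ≤ x → x ≤ n + 1 → y ≠ k → 1 ≤ y → y ≤ n + 1 →
      (reverseSkip n k x < reverseSkip n k y ↔ y < x) := by
    intro x y _ _ _ _ _ _
    unfold reverseSkip
    split_ifs <;> omega
  have hrange : ∀ x, x ≠ k → 1 ≤ x → x ≤ n + 1 →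
      1 ≤ reverseSkip n k x ∧ reverseSkip n k x ≤ n := by
    intro x _ _ _
    unfold reverseSkip
    split_ifs <;> omega
  have hrange' : ∀ y, 1 ≤ y → y ≤ n →
      reverseAvoid n k y ≠ k ∧ 1 ≤ reverseAvoid n k y ∧ reverseAvoid n k y ≤ n + 1 := by
    intro x _ _
    unfold reverseAvoid
    split_ifs <;> omega
  refine Set.ncard_congr (fun l _ => l.tail.map (reverseSkip n k)) ?_ ?_ ?_
  · intro l hl
    obtain ⟨t, rfl⟩ := hcons hl
    obtain ⟨hp, hd, -⟩ := hl
    have hm := hmem hp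
    have hd' := (downUpWord_cons_map_iff (f := reverseSkip n k) fun x hx y hy =>
      hanti x y (hm x hx).1 (hm x hx).2.1 (hm x hx).2.2 (hm y hy).1 (hm y hy).2.1
        (hm y hy).2.2).1 hd
    refine ⟨?_, hd'.1, ?_⟩
    · rw [perm_range'_one_iff] at hp ⊢
      constructor
      · refine List.Nodup.map_on ?_ (List.nodup_cons.1 hp.1).2
        intro x hx y hy hxy
        rw [← hleft x (hm x hx).1 (hm x hx).2.1 (hm x hx).2.2, hxy,
          hleft y (hm y hy).1 (hm y hy).2.1 (hm y hy).2.2]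
      · intro y
        rw [List.tail_cons, List.mem_map]
        constructor
        · rintro ⟨x, hx, rfl⟩
          exact hrange x (hm x hx).1 (hm x hx).2.1 (hm x hx).2.2
        · rintro ⟨h1, h2⟩
          obtain ⟨h3, h4⟩ := hrange' y h1 h2
          exact ⟨_, ((List.mem_cons.1 ((hp.2 _).2 h4)).resolve_left h3), hright y h1 h2⟩
    · rcases t with _ | ⟨x, s⟩
      · have := hp.length_eq
        simp at this
        omega
      · refine ⟨_, rfl, ?_⟩
        have hx := hd'.2 x rfl
        simp only [reverseSkip, if_pos hx]
        omega
  · intro l l' hl hl' h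
    obtain ⟨t, rfl⟩ := hcons hl
    obtain ⟨t', rfl⟩ := hcons hl'
    have key : ∀ {t : List ℕ}, (k :: t).Perm (List.range' 1 (n + 1)) →
        (t.map (reverseSkip n k)).map (reverseAvoid n k) = t := by
      intro t ht
      rw [List.map_map]
      refine (List.map_congr_left fun x hx => ?_).trans (List.map_id t)
      have hm := hmem ht x hx
      exact hleft x hm.1 hm.2.1 hm.2.2
    simp only [List.tail_cons] at h
    rw [← key hl.1, h, key hl'.1]
  · rintro w ⟨hp, hd, y, hy, hyk⟩
    obtain ⟨s, rfl⟩ := List.head?_eq_some_iff.1 hy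
    have hm := (perm_range'_one_iff.1 hp).2
    have hback : (((y :: s).map (reverseAvoid n k)).map (reverseSkip n k)) = y :: s := by
      rw [List.map_map]
      refine (List.map_congr_left fun x hx => ?_).trans (List.map_id _)
      exact hright x ((hm x).1 hx).1 ((hm x).1 hx).2
    refine ⟨k :: (y :: s).map (reverseAvoid n k), ⟨?_, ?_, k, rfl, rfl⟩, hback⟩
    · rw [perm_range'_one_iff]
      constructor
      · refine List.nodup_cons.2 ⟨fun h => ?_, List.Nodup.map_on ?_ (perm_range'_one_iff.1 hp).1⟩
        · obtain ⟨x, hx, h1⟩ := List.mem_map.1 h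
          exact (hrange' x ((hm x).1 hx).1 ((hm x).1 hx).2).1 h1
        · intro a ha b hb hab
          rw [← hright a ((hm a).1 ha).1 ((hm a).1 ha).2, hab,
            hright b ((hm b).1 hb).1 ((hm b).1 hb).2]
      · intro x
        rw [List.mem_cons, List.mem_map]
        constructor
        · rintro (rfl | ⟨a, ha, rfl⟩)
          · exact ⟨hk, hkn⟩
          · exact (hrange' a ((hm a).1 ha).1 ((hm a).1 ha).2).2
        · rintro ⟨h1, h2⟩
          by_cases hxk : x = k
          · exact Or.inl hxk
          · exact Or.inr ⟨_, (hm _).2 (hrange x hxk h1 h2), hleft x hxk h1 h2⟩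
    · refine (downUpWord_cons_map_iff (f := reverseSkip n k) ?_).2 ⟨by rwa [hback], ?_⟩
      · intro a' ha' b' hb'
        obtain ⟨a, ha, rfl⟩ := List.mem_map.1 ha'
        obtain ⟨b, hb, rfl⟩ := List.mem_map.1 hb'
        obtain ⟨h1, h2, h3⟩ := hrange' a ((hm a).1 ha).1 ((hm a).1 ha).2
        obtain ⟨h4, h5, h6⟩ := hrange' b ((hm b).1 hb).1 ((hm b).1 hb).2
        exact hanti _ _ h1 h2 h3 h4 h5 h6
      · intro x hx
        obtain rfl : reverseAvoid n k y = x := by simpa using hx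
        unfold reverseAvoid
        split_ifs <;> omega

theorem ncard_downUpFirst_add (n a : ℕ) :
    (downUpFirst n (a ≤ ·)).ncard =
      (downUpFirst n (a + 1 ≤ ·)).ncard + (downUpFirst n (· = a)).ncard := by
  rw [← Set.ncard_union_eq _ (finite_downUpFirst _ _) (finite_downUpFirst _ _)]
  · congr 1
    ext l
    constructor
    · rintro ⟨hp, hd, k, hk, hak⟩
      rcases Nat.eq_or_lt_of_le hak with rfl | h
      · exact Or.inr ⟨hp, hd, _, hk, rfl⟩
      · exact Or.inl ⟨hp, hd, k, hk, h⟩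
    · rintro (⟨hp, hd, k, hk, h⟩ | ⟨hp, hd, k, hk, rfl⟩)
      · exact ⟨hp, hd, k, hk, Nat.le_of_succ_le h⟩
      · exact ⟨hp, hd, k, hk, le_rfl⟩
  · rw [Set.disjoint_left]
    rintro l ⟨-, -, k, hk, h⟩ ⟨-, -, k', hk', rfl⟩
    obtain rfl : k = k' := by simpa [hk] using hk'
    exact Nat.lt_irrefl _ h

theorem ncard_downUpFirst_one {n : ℕ} (hn : 2 ≤ n) : (downUpFirst n (· = 1)).ncard = 0 := by
  obtain ⟨m, rfl⟩ : ∃ m, n = m + 1 := ⟨n - 1, by omega⟩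
  rw [ncard_downUpFirst_eq (by omega) le_rfl (by omega)]
  convert Set.ncard_empty (List ℕ)
  rw [Set.eq_empty_iff_forall_notMem]
  rintro l ⟨hp, -, k, hk, h⟩
  have := ((perm_range'_one_iff.1 hp).2 k).1 (List.mem_of_head? hk)
  omega

theorem ncard_downUpFirst_one_one : (downUpFirst 1 (· = 1)).ncard = 1 := by
  rw [Set.ncard_eq_one]
  refine ⟨[1], Set.eq_singleton_iff_unique_mem.2 ⟨⟨by simp, ?_, 1, rfl, rfl⟩, ?_⟩⟩
  · intro i hi
    simp at hi
  · rintro l ⟨hp, -⟩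
    simpa using hp

theorem ncard_downUpFirst_eq_of_recurrence (E : ℕ → ℕ → ℕ) (hE11 : E 1 1 = 1)
    (hEn1 : ∀ n : ℕ, 2 ≤ n → E n 1 = 0)
    (hErec : ∀ n k : ℕ, 2 ≤ k → k ≤ n → E n k = E n (k - 1) + E (n - 1) (n + 1 - k))
    (n k : ℕ) (hk : 1 ≤ k) (hkn : k ≤ n) : (downUpFirst n (· = k)).ncard = E n k := by
  induction n using Nat.strong_induction_on generalizing k with
  | _ n ihn =>
  induction k, hk using Nat.le_induction with
  | base =>
    rcases Nat.eq_or_lt_of_le hkn with rfl | h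
    · rw [ncard_downUpFirst_one_one, hE11]
    · rw [ncard_downUpFirst_one h, hEn1 n h]
  | succ k hk ihk =>
    obtain ⟨m, rfl⟩ : ∃ m, n = m + 1 := ⟨n - 1, by omega⟩
    rw [hErec (m + 1) (k + 1) (by omega) hkn, Nat.add_sub_cancel, Nat.add_sub_cancel,
      ← ihk (by omega), ← ihn m (by omega) _ (by omega) (by omega),
      ncard_downUpFirst_eq (by omega) (by omega) hkn,
      ncard_downUpFirst_eq (by omega) hk (by omega), ncard_downUpFirst_add]
    rw [show m + 2 - (k + 1) + 1 = m + 2 - k by omega,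
      show m + 1 + 1 - (k + 1) = m + 2 - (k + 1) by omega]

/-- For `1 ≤ k ≤ n`, the number of André permutations of `[n]` with last entry `k`
equals the number of down-up alternating permutations of `[n]` with first entry `k`,
and hence equals the Entringer number `E n k`. -/
theorem card_andre_last_eq_card_downUp_first
    (E : ℕ → ℕ → ℕ)
    (hE11 : E 1 1 = 1)
    (hEn1 : ∀ n : ℕ, 2 ≤ n → E n 1 = 0)
    (hErec : ∀ n k : ℕ, 2 ≤ k → k ≤ n → E n k = E n (k - 1) + E (n - 1) (n + 1 - k))
    (n k : ℕ) (hn : 1 ≤ n) (hk : 1 ≤ k) (hkn : k ≤ n) :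
    Nat.card {l : List ℕ // IsAndre n l ∧ l.getLast? = some k}
        = Nat.card {l : List ℕ // l.Perm (List.range' 1 n) ∧ DownUpWord l ∧ l.head? = some k} ∧
    Nat.card {l : List ℕ // IsAndre n l ∧ l.getLast? = some k} = E n k := by
  have hA := card_andre_last_eq_of_recurrence E hE11 hEn1 hErec n k hk hkn
  refine ⟨?_, hA⟩
  rw [hA, ← ncard_downUpFirst_eq_of_recurrence E hE11 hEn1 hErec n k hk hkn,
    ← Nat.card_coe_set_eq]
  simp only [downUpFirst, exists_eq_right]
  rfl
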